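/- Let R be a finite set, a, b ∈ R, let A be any real R×R matrix, and let B be its off-diagonal part (B_{x,y} = A_{x,y} for x ≠ y and B_{x,x} = 0). Then for every l ∈ (0,∞)^R: (det_{ab}^{(R)}(−A + ∂_l) G_A)(l) = ∫_{[0,2π]^R} det_{ab}^{(R)}(−B + V_{θ,l}) · exp(Σ_{x,y∈R} A_{x,y} √(l_x l_y) e^{i(θ_x−θ_y)}) ∏_{x∈R} dθ_x/(2π), where V_{θ,l} is the diagonal complex R×R matrix with entries v_{θ,l}(x) = Σ_{z∈R} B_{x,z} √(l_z/l_x) e^{i(θ_x−θ_z)}; note that the right-hand integrand involves the cofactor determinant of an actual complex matrix and no derivatives. -/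

import Mathlib

open MeasureTheory Finset
noncomputable section

/-- The `(b,a)` cofactor of the `S × S` submatrix of `M`. -/
def cofDet {α : Type*} [Fintype α] [DecidableEq α]
    (S : Finset α) (M : Matrix α α ℂ) (a b : α) : ℂ :=
  (Matrix.of fun x y : S => if (x : α) = b then (if (y : α) = a then (1:ℂ) else 0)
    else (if (y : α) = a then 0 else M x y)).det

/-- Partial derivative in direction `x`. -/
def pd {α : Type*} [Fintype α] [DecidableEq α] (x : α) (f : (α → ℝ) → ℂ) :
    (α → ℝ) → ℂ :=
  fun l => fderiv ℝ f l (Pi.single x 1)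

/-- Mixed partial derivative `∂^Q f`. -/
def mpart {α : Type*} [Fintype α] [DecidableEq α] (Q : Finset α) (f : (α → ℝ) → ℂ) :
    (α → ℝ) → ℂ :=
  Q.toList.foldr pd f

/-- The differential operator `det_{ab}^{(α)}(M + ∂_l)` applied to `f` at `l`. -/
def ddet {α : Type*} [Fintype α] [DecidableEq α]
    (M : Matrix α α ℂ) (a b : α) (f : (α → ℝ) → ℂ) (l : α → ℝ) : ℂ :=
  ∑ Q ∈ ((Finset.univ : Finset α) \ {a, b}).powerset,
    cofDet ((Finset.univ : Finset α) \ Q) M a b * mpart Q f l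

/-- `G_M(l) = ∫_{[0,2π]^α} exp(Σ_{x,y} M_{x,y} √(l_x l_y) e^{i(θ_x−θ_y)}) ∏ dθ_x/(2π)`. -/
def GM {α : Type*} [Fintype α] [DecidableEq α] (M : Matrix α α ℝ) (l : α → ℝ) : ℂ :=
  ((2 * Real.pi : ℂ) ^ (Fintype.card α))⁻¹ *
    ∫ θ in Set.univ.pi (fun _ : α => Set.Icc (0:ℝ) (2 * Real.pi)),
      Complex.exp (∑ x, ∑ y, (M x y : ℂ) * (Real.sqrt (l x * l y) : ℂ) *
        Complex.exp (Complex.I * ((θ x : ℂ) - (θ y : ℂ))))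

/-- The local-time density `ρ_{ab}(l) = (det_{ab}(−A + ∂_l) G_A)(l)`. -/
def rho {α : Type*} [Fintype α] [DecidableEq α]
    (A : Matrix α α ℝ) (a b : α) (l : α → ℝ) : ℂ :=
  ddet ((-A).map (fun r => (r : ℂ))) a b (GM A) l


lemma hasFDerivAt_box {R 𝕜 H : Type*} [Fintype R] [RCLike 𝕜] [NormedAddCommGroup H] [NormedSpace 𝕜 H]
    [NormedSpace 𝕜 ℂ]
    [ProperSpace H] {f : H → (R → ℝ) → ℂ} {f' : H → (R → ℝ) → H →L[𝕜] ℂ}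
    (hf : Continuous (Function.uncurry f)) (hf' : Continuous (Function.uncurry f'))
    (hd : ∀ x θ, HasFDerivAt (f · θ) (f' x θ) x) {K : Set (R → ℝ)} (hK : IsCompact K) (x : H) :
    HasFDerivAt (fun x => ∫ θ in K, f x θ) (∫ θ in K, f' x θ) x := by
  have hc := ((isCompact_closedBall x 1).prod hK).exists_bound_of_continuousOn
    hf'.continuousOn
  obtain ⟨C, hC⟩ := hc
  have h1 : ∀ x, Continuous (f x) := fun x => hf.comp (by fun_prop : Continuous fun θ => (x, θ))
  have h2 : ∀ x, Continuous (f' x) := fun x => hf'.comp (by fun_prop : Continuous fun θ => (x, θ))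
  refine hasFDerivAt_integral_of_dominated_of_fderiv_le (s := Metric.closedBall x 1)
    (bound := fun _ => C) (Metric.closedBall_mem_nhds x one_pos) ?_ ?_ ?_ ?_ ?_ ?_
  · exact Filter.Eventually.of_forall fun y => (h1 y).aestronglyMeasurable
  · exact (h1 x).continuousOn.integrableOn_compact hK
  · exact (h2 x).aestronglyMeasurable
  · refine (ae_restrict_iff' hK.measurableSet).2 (Filter.Eventually.of_forall fun θ hθ y hy => ?_)
    exact hC (y, θ) ⟨hy, hθ⟩
  · exact continuousOn_const.integrableOn_compact hK
  · exact Filter.Eventually.of_forall fun θ y _ => hd y θ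

instance fact_two_pi : Fact (0 < 2 * Real.pi) := ⟨Real.two_pi_pos⟩

lemma toCircle_two_pi (t : ℝ) :
    ((AddCircle.toCircle (t : AddCircle (2 * Real.pi)) : Circle) : ℂ) =
      Complex.exp (Complex.I * (t : ℂ)) := by
  rw [AddCircle.toCircle_apply_mk, div_self Real.two_pi_pos.ne', one_mul, Circle.coe_exp, mul_comm]

lemma box_eq_torus {R : Type*} [Fintype R] (P : (R → ℂ) → ℂ) (hP : Measurable P) :
    ∫ θ in Set.univ.pi (fun _ : R => Set.Icc (0:ℝ) (2 * Real.pi)),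
      P (fun x => Complex.exp (Complex.I * (θ x : ℂ))) =
    ∫ φ : R → AddCircle (2 * Real.pi), P (fun x => ((φ x).toCircle : ℂ)) := by
  have h := measurePreserving_pi (ι := R) _ _
    (fun i => AddCircle.measurePreserving_mk (2 * Real.pi) 0)
  have hm : Measurable (fun φ : R → AddCircle (2 * Real.pi) =>
      P (fun x => ((φ x).toCircle : ℂ))) := by
    refine hP.comp (measurable_pi_lambda _ fun x => ?_)
    have : Continuous (fun φ : AddCircle (2 * Real.pi) => (φ.toCircle : ℂ)) :=
      continuous_subtype_val.comp AddCircle.continuous_toCircle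
    exact this.measurable.comp (measurable_pi_apply x)
  rw [volume_pi, volume_pi, ← h.map_eq, integral_map h.measurable.aemeasurable hm.aestronglyMeasurable,
    Measure.restrict_pi_pi]
  simp only [zero_add, restrict_Ioc_eq_restrict_Icc, toCircle_two_pi]

lemma box_translate {R : Type*} [Fintype R] (P : (R → ℂ) → ℂ) (hP : Measurable P) (t : R → ℝ) :
    ∫ θ in Set.univ.pi (fun _ : R => Set.Icc (0:ℝ) (2 * Real.pi)),
      P (fun x => Complex.exp (Complex.I * (θ x : ℂ)) * Complex.exp (Complex.I * (t x : ℂ))) =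
    ∫ θ in Set.univ.pi (fun _ : R => Set.Icc (0:ℝ) (2 * Real.pi)),
      P (fun x => Complex.exp (Complex.I * (θ x : ℂ))) := by
  have e1 := box_eq_torus (fun z => P (fun x => z x * Complex.exp (Complex.I * (t x : ℂ)))) (by fun_prop)
  refine e1.trans ?_
  rw [box_eq_torus P hP, ← integral_add_right_eq_self
    (fun φ : R → AddCircle (2 * Real.pi) => P (fun x => ((φ x).toCircle : ℂ)))
    (fun x => (t x : AddCircle (2 * Real.pi)))]
  simp only [Pi.add_apply, AddCircle.toCircle_add, Circle.coe_mul, toCircle_two_pi]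

lemma box_shift {R : Type*} [Fintype R] (P : (R → ℂ) → ℂ) (hP : Measurable P)
    (hK : ContDiff ℂ 1 (fun ζ : R → ℂ => P (fun x => Complex.exp (Complex.I * ζ x)))) (s : R → ℝ) :
    ∫ θ in Set.univ.pi (fun _ : R => Set.Icc (0:ℝ) (2 * Real.pi)),
      P (fun x => Complex.exp (Complex.I * (θ x : ℂ)) * Complex.exp (s x : ℂ)) =
    ∫ θ in Set.univ.pi (fun _ : R => Set.Icc (0:ℝ) (2 * Real.pi)),
      P (fun x => Complex.exp (Complex.I * (θ x : ℂ))) := by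
  set K : (R → ℂ) → ℂ := fun ζ : R → ℂ => P (fun x => Complex.exp (Complex.I * ζ x)) with hKdef
  set Hf : ℂ → ℂ := fun w => ∫ θ in Set.univ.pi (fun _ : R => Set.Icc (0:ℝ) (2 * Real.pi)),
    K ((fun x => (θ x : ℂ)) + w • (fun x => (s x : ℂ))) with hHf
  have hbox : IsCompact (Set.univ.pi (fun _ : R => Set.Icc (0:ℝ) (2 * Real.pi))) :=
    isCompact_univ_pi fun _ => isCompact_Icc
  have hd : Differentiable ℂ Hf := by
    intro w
    refine (hasFDerivAt_box (𝕜 := ℂ)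
      (f := fun (w : ℂ) (θ : R → ℝ) => K ((fun x => (θ x : ℂ)) + w • (fun x => (s x : ℂ))))
      (f' := fun w θ => (fderiv ℂ K ((fun x => (θ x : ℂ)) + w • (fun x => (s x : ℂ)))).comp
        ((ContinuousLinearMap.id ℂ ℂ).smulRight (fun x => (s x : ℂ)))) ?_ ?_ ?_ hbox w).differentiableAt
    · exact hK.continuous.comp (by fun_prop)
    · have h1 := hK.continuous_fderiv (by norm_num)
      refine Continuous.clm_comp (h1.comp (by fun_prop)) continuous_const
    · intro w θ
      have h1 := (hK.differentiable (by norm_num) ((fun x => (θ x : ℂ)) + w • (fun x => (s x : ℂ)))).hasFDerivAt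
      refine HasFDerivAt.comp (g := K) w h1 ?_
      exact ((ContinuousLinearMap.id ℂ ℂ).smulRight (fun x => (s x : ℂ))).hasFDerivAt.const_add _
  have htr : ∀ (w : ℂ) (t : ℝ), Hf (w + t) = Hf w := by
    intro w t
    have := box_translate (fun z => P (fun x => z x * Complex.exp (Complex.I * (w * s x)))) (by fun_prop)
      (fun x => t * s x)
    simp only [hHf, hKdef, Pi.add_apply, Pi.smul_apply, smul_eq_mul]
    refine Eq.trans ?_ (this.trans ?_)
    · congr 1; ext θ; congr 1; ext x
      dsimp only
      rw [← Complex.exp_add, ← Complex.exp_add]; congr 1; push_cast; ring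
    · congr 1; ext θ; congr 1; ext x
      dsimp only
      rw [← Complex.exp_add]; congr 1; ring
  have hz : ∀ w, deriv Hf w = 0 := by
    intro w
    have h1 : HasDerivAt (fun z => Hf (w + z)) (deriv Hf w) ((0 : ℝ) : ℂ) := by
      have := (hd (w + ((0:ℝ):ℂ))).hasDerivAt.comp_const_add w ((0:ℝ):ℂ)
      simpa using this
    have h2 := h1.comp_ofReal
    simp only [htr] at h2
    exact h2.unique (hasDerivAt_const _ _)
  have := is_const_of_deriv_eq_zero hd hz (-Complex.I) 0
  simp only [hHf, hKdef, Pi.add_apply, Pi.smul_apply, smul_eq_mul] at this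
  refine Eq.trans ?_ (this.trans ?_)
  · congr 1; ext θ; congr 1; ext x
    rw [← Complex.exp_add]; congr 1; linear_combination (s x:ℂ) * Complex.I_mul_I
  · simp


lemma cofDet_expand {α : Type*} [Fintype α] [DecidableEq α] (M : Matrix α α ℂ) (a b : α)
    (d : α → ℂ) :
    cofDet (Finset.univ : Finset α) (M + Matrix.diagonal d) a b =
      ∑ Q ∈ ((Finset.univ : Finset α) \ {a, b}).powerset,
        cofDet ((Finset.univ : Finset α) \ Q) M a b * ∏ x ∈ Q, d x := by
  set Cm : Matrix α α ℂ → Matrix α α ℂ := fun M => Matrix.of fun x y : α =>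
    if x = b then (if y = a then (1:ℂ) else 0) else (if y = a then 0 else M x y) with hCm
  have hcof : ∀ (S : Finset α) (N : Matrix α α ℂ), cofDet S N a b =
      (Matrix.of (S.piecewise (Cm N).row (1 : Matrix α α ℂ).row)).det := by
    intro S N
    rw [Matrix.det_piecewise_one_eq_submatrix_det]
    rfl
  set d' : α → ℂ := fun x => if x = a ∨ x = b then 0 else d x with hd'
  have hsplit : Cm (M + Matrix.diagonal d) =
      (Cm M).row + fun x => d' x • (1 : Matrix α α ℂ).row x := by
    ext x y
    change (if x = b then (if y = a then (1:ℂ) else 0) else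
        (if y = a then 0 else M x y + Matrix.diagonal d x y)) =
      (if x = b then (if y = a then (1:ℂ) else 0) else (if y = a then 0 else M x y)) +
        (if x = a ∨ x = b then 0 else d x) * (1 : Matrix α α ℂ) x y
    clear hcof hCm hd'
    rw [Matrix.diagonal_apply, Matrix.one_apply]
    by_cases h1 : x = b <;> by_cases h2 : y = a <;> by_cases h3 : x = y <;> by_cases h4 : x = a <;>
      simp_all
  have hD : ∀ S : Finset α, (Matrix.of (S.piecewise (Cm M).row
      (fun x => d' x • (1 : Matrix α α ℂ).row x))).det = cofDet S M a b * ∏ x ∈ Sᶜ, d' x := by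
    intro S
    rw [hcof]
    have : (Matrix.of (S.piecewise (Cm M).row (fun x => d' x • (1 : Matrix α α ℂ).row x))) =
      Matrix.of fun x y => (if x ∈ S then 1 else d' x) *
        (Matrix.of (S.piecewise (Cm M).row (1 : Matrix α α ℂ).row)) x y := by
      ext x y
      by_cases hx : x ∈ S <;> simp [Finset.piecewise, hx]
    rw [this, Matrix.det_mul_column, mul_comm]
    congr 1
    rw [← Finset.prod_mul_prod_compl S]
    rw [Finset.prod_congr rfl (g := fun _ => 1) (fun x hx => by simp [hx]), Finset.prod_const_one,
      one_mul]
    exact Finset.prod_congr rfl (fun x hx => by simp [Finset.mem_compl.1 hx])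
  have h0 : cofDet (Finset.univ : Finset α) (M + Matrix.diagonal d) a b =
      Matrix.detRowAlternating (Cm (M + Matrix.diagonal d)) := by
    rw [hcof, Finset.piecewise_univ]; rfl
  rw [h0, hsplit, AlternatingMap.map_add_univ]
  have h1 : ∀ S : Finset α, Matrix.detRowAlternating (S.piecewise (Cm M).row
      (fun x => d' x • (1 : Matrix α α ℂ).row x)) = cofDet S M a b * ∏ x ∈ Sᶜ, d' x := hD
  simp only [h1]
  rw [← Equiv.sum_comp (Equiv.ofBijective (compl : Finset α → Finset α) compl_bijective)]
  simp only [Equiv.ofBijective_apply, compl_compl]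
  symm
  refine Finset.sum_subset_zero_on_sdiff (Finset.subset_univ _) ?_ ?_
  · intro Q hQ
    have : ∃ x ∈ Q, x = a ∨ x = b := by
      by_contra hcon
      push Not at hcon
      apply (Finset.mem_sdiff.1 hQ).2
      rw [Finset.mem_powerset]
      intro x hx
      have := hcon x hx
      simp [this]
    obtain ⟨x, hx, hxx⟩ := this
    rw [Finset.prod_eq_zero hx (by simp [hd', hxx]), mul_zero]
  · intro Q hQ
    rw [Finset.compl_eq_univ_sdiff]
    congr 1
    refine Finset.prod_congr rfl fun x hx => ?_
    have := Finset.mem_powerset.1 hQ hx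
    simp at this
    simp [hd', this]

/-- The linear coefficient. -/
def cc {R : Type*} [Fintype R] (A : Matrix R R ℝ) (θ : R → ℝ) (x : R) : ℂ :=
  ∑ y, (A x y : ℂ) * Complex.exp (Complex.I * ((θ x : ℂ) - (θ y : ℂ)))

/-- The linearized integral. -/
def JJ {R : Type*} [Fintype R] (A : Matrix R R ℝ) (L : List R) (l : R → ℝ) : ℂ :=
  ∫ θ in Set.univ.pi (fun _ : R => Set.Icc (0:ℝ) (2 * Real.pi)),
    (L.map (cc A θ)).prod * Complex.exp (∑ x, (l x : ℂ) * cc A θ x)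

lemma continuous_cc {R : Type*} [Fintype R] (A : Matrix R R ℝ) (x : R) :
    Continuous (fun θ => cc A θ x) := by
  unfold cc; fun_prop

lemma continuous_listprod {X R : Type*} [TopologicalSpace X] (g : X → R → ℂ)
    (hg : ∀ x, Continuous (fun θ => g θ x)) (L : List R) :
    Continuous (fun θ => (L.map (g θ)).prod) := by
  induction L with
  | nil => simpa using continuous_const
  | cons x L ih => simp only [List.map_cons, List.prod_cons]; exact (hg x).mul ih

lemma measurable_listprod {X R : Type*} [MeasurableSpace X] (g : X → R → ℂ)
    (hg : ∀ x, Measurable (fun θ => g θ x)) (L : List R) :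
    Measurable (fun θ => (L.map (g θ)).prod) := by
  induction L with
  | nil => simp
  | cons x L ih => simp only [List.map_cons, List.prod_cons]; exact (hg x).mul ih

lemma contDiff_listprod {X R : Type*} [NormedAddCommGroup X] [NormedSpace ℂ X] (g : X → R → ℂ)
    (hg : ∀ x, ContDiff ℂ 1 (fun θ => g θ x)) (L : List R) :
    ContDiff ℂ 1 (fun θ => (L.map (g θ)).prod) := by
  induction L with
  | nil => simpa using contDiff_const
  | cons x L ih => simpa using (hg x).mul ih

lemma isCompact_box (R : Type*) :
    IsCompact (Set.univ.pi (fun _ : R => Set.Icc (0:ℝ) (2 * Real.pi))) :=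
  isCompact_univ_pi fun _ => isCompact_Icc

lemma pd_JJ {R : Type*} [Fintype R] [DecidableEq R] (A : Matrix R R ℝ) (L : List R) (x : R) :
    pd x (JJ A L) = JJ A (x :: L) := by
  ext l
  have hcc := continuous_cc A
  have hL := continuous_listprod (cc A) hcc L
  set Λ : (R → ℝ) → ((R → ℝ) →L[ℝ] ℂ) := fun θ =>
    ∑ x, (ContinuousLinearMap.proj (R := ℝ) (φ := fun _ : R => ℝ) x).smulRight (cc A θ x) with hΛ
  have hΛa : ∀ θ l, Λ θ l = ∑ x, (l x : ℂ) * cc A θ x := by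
    intro θ l
    simp [hΛ]
  have hΛc : Continuous Λ := by
    rw [hΛ]
    refine continuous_finsetSum _ fun x _ => ?_
    exact (ContinuousLinearMap.smulRightL ℝ (R → ℝ) ℂ
      (ContinuousLinearMap.proj (R := ℝ) (φ := fun _ : R => ℝ) x)).continuous.comp (hcc x)
  set f' : (R → ℝ) → (R → ℝ) → ((R → ℝ) →L[ℝ] ℂ) := fun l θ =>
    ((L.map (cc A θ)).prod * Complex.exp (∑ x, (l x : ℂ) * cc A θ x)) • Λ θ with hf'
  have hc1 : Continuous (Function.uncurry fun (l θ : R → ℝ) =>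
      (L.map (cc A θ)).prod * Complex.exp (∑ x, (l x : ℂ) * cc A θ x)) := by
    have := fun x => (hcc x).comp (continuous_snd (X := R → ℝ))
    refine (hL.comp continuous_snd).mul (Complex.continuous_exp.comp ?_)
    refine continuous_finsetSum _ fun x _ => Continuous.mul (by fun_prop) (this x)
  have hc2 : Continuous (Function.uncurry f') := hc1.smul (hΛc.comp continuous_snd)
  have key := hasFDerivAt_box (𝕜 := ℝ) hc1 hc2 ?_ (isCompact_box R) l
  · have hint : Integrable (f' l) (volume.restrict (Set.univ.pi (fun _ : R => Set.Icc (0:ℝ) (2 * Real.pi)))) :=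
      (hc2.comp (by fun_prop : Continuous fun θ => (l, θ))).continuousOn.integrableOn_compact
        (isCompact_box R)
    have e : pd x (JJ A L) l = (∫ θ in Set.univ.pi (fun _ : R => Set.Icc (0:ℝ) (2 * Real.pi)), f' l θ) (Pi.single x 1) := by
      unfold pd
      rw [← key.fderiv]; rfl
    rw [e, ContinuousLinearMap.integral_apply hint]
    unfold JJ
    congr 1
    ext θ
    have : Λ θ (Pi.single x 1) = cc A θ x := by
      rw [hΛa, Finset.sum_eq_single x] <;> simp +contextual
    simp only [hf', smul_apply, this, smul_eq_mul, List.map_cons, List.prod_cons]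
    ring
  · intro l θ
    have h1 : HasFDerivAt (fun l : R → ℝ => ∑ x, (l x : ℂ) * cc A θ x) (Λ θ) l := by
      have := (Λ θ).hasFDerivAt (x := l)
      rwa [show (⇑(Λ θ)) = fun l : R → ℝ => ∑ x, (l x : ℂ) * cc A θ x from funext (hΛa θ)] at this
    have h2 := h1.cexp.const_mul (L.map (cc A θ)).prod
    rw [hf']
    rw [smul_smul] at h2
    exact h2

lemma JJ_shift {R : Type*} [Fintype R] (A : Matrix R R ℝ) (L : List R)
    (l : R → ℝ) (hl : ∀ x, 0 < l x) :
    JJ A L l = ∫ θ in Set.univ.pi (fun _ : R => Set.Icc (0:ℝ) (2 * Real.pi)),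
      (L.map (fun x => ∑ y, (A x y : ℂ) * (Real.sqrt (l y / l x) : ℂ) *
        Complex.exp (Complex.I * ((θ x : ℂ) - (θ y : ℂ))))).prod *
      Complex.exp (∑ x, ∑ y, (A x y : ℂ) * (Real.sqrt (l x * l y) : ℂ) *
        Complex.exp (Complex.I * ((θ x : ℂ) - (θ y : ℂ)))) := by
  set P : (R → ℂ) → ℂ := fun z => (L.map (fun x => ∑ y, (A x y : ℂ) * (z x * (z y)⁻¹))).prod *
    Complex.exp (∑ x, (l x : ℂ) * ∑ y, (A x y : ℂ) * (z x * (z y)⁻¹)) with hP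
  have hexp : ∀ u v : ℂ, Complex.exp (Complex.I * u) * (Complex.exp (Complex.I * v))⁻¹ =
      Complex.exp (Complex.I * (u - v)) := by
    intro u v
    rw [← Complex.exp_neg, ← Complex.exp_add]; congr 1; ring
  have hPm : Measurable P := by
    refine Measurable.mul (measurable_listprod _ (fun x => ?_) L) ?_ <;> fun_prop
  have hPK : ContDiff ℂ 1 (fun ζ : R → ℂ => P (fun x => Complex.exp (Complex.I * ζ x))) := by
    simp only [hP, hexp]
    refine ContDiff.mul (contDiff_listprod _ (fun x => ?_) L) ?_ <;> fun_prop
  have h := box_shift P hPm hPK (fun x => -Real.log (Real.sqrt (l x)))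
  have hs : ∀ x, Complex.exp ((-Real.log (Real.sqrt (l x)) : ℝ) : ℂ) = ((Real.sqrt (l x))⁻¹ : ℝ) := by
    intro x
    rw [← Complex.ofReal_exp, Real.exp_neg, Real.exp_log (Real.sqrt_pos.2 (hl x))]
  have hne : ∀ x, (Real.sqrt (l x) : ℂ) ≠ 0 := fun x =>
    Complex.ofReal_ne_zero.2 (Real.sqrt_pos.2 (hl x)).ne'
  have hsq : ∀ x, (l x : ℂ) = (Real.sqrt (l x) : ℂ) * (Real.sqrt (l x) : ℂ) := fun x => by
    rw [← Complex.ofReal_mul, Real.mul_self_sqrt (hl x).le]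
  have hJ : JJ A L l = ∫ θ in Set.univ.pi (fun _ : R => Set.Icc (0:ℝ) (2 * Real.pi)),
      P (fun x => Complex.exp (Complex.I * (θ x : ℂ))) := by
    simp only [hP, hexp]; rfl
  rw [hJ, ← h]
  congr 1
  ext θ
  have e1 : ∀ x y, Complex.exp (Complex.I * (θ x : ℂ)) * Complex.exp ((-Real.log (Real.sqrt (l x)) : ℝ) : ℂ) *
      (Complex.exp (Complex.I * (θ y : ℂ)) * Complex.exp ((-Real.log (Real.sqrt (l y)) : ℝ) : ℂ))⁻¹ =
      (Real.sqrt (l y / l x) : ℂ) * Complex.exp (Complex.I * ((θ x : ℂ) - (θ y : ℂ))) := by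
    intro x y
    rw [hs, hs, ← hexp, Real.sqrt_div (hl y).le]
    push_cast
    have := hne x
    have := hne y
    have := Complex.exp_ne_zero (Complex.I * (θ y : ℂ))
    field_simp
  have e2 : ∀ x y, (l x : ℂ) * (Real.sqrt (l y / l x) : ℂ) = (Real.sqrt (l x * l y) : ℂ) := by
    intro x y
    rw [Real.sqrt_div (hl y).le, Real.sqrt_mul (hl x).le, hsq x]
    push_cast
    have := hne x
    field_simp
  simp only [hP, e1]
  congr 2
  · simp only [mul_assoc]
  · refine Finset.sum_congr rfl fun x _ => ?_
    rw [Finset.mul_sum]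
    refine Finset.sum_congr rfl fun y _ => ?_
    rw [← e2]; ring

lemma GM_eq_JJ {R : Type*} [Fintype R] [DecidableEq R] (A : Matrix R R ℝ) (l : R → ℝ)
    (hl : ∀ x, 0 < l x) :
    GM A l = ((2 * Real.pi : ℂ) ^ (Fintype.card R))⁻¹ * JJ A [] l := by
  rw [JJ_shift A [] l hl]
  simp [GM]

lemma foldr_GM {R : Type*} [Fintype R] [DecidableEq R] (A : Matrix R R ℝ) (L : List R) :
    ∀ l : R → ℝ, (∀ x, 0 < l x) → L.foldr pd (GM A) l =
      ((2 * Real.pi : ℂ) ^ (Fintype.card R))⁻¹ * JJ A L l := by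
  induction L with
  | nil => exact GM_eq_JJ A
  | cons x L ih =>
    intro l hl
    have ho : IsOpen {l : R → ℝ | ∀ x, 0 < l x} := by
      simp only [Set.ofPred_forall]
      exact isOpen_iInter_of_finite fun x => isOpen_lt continuous_const (continuous_apply x)
    have hev : L.foldr pd (GM A) =ᶠ[nhds l]
        fun l => ((2 * Real.pi : ℂ) ^ (Fintype.card R))⁻¹ * JJ A L l :=
      Filter.eventually_of_mem (ho.mem_nhds hl) fun l hl => ih l hl
    rw [List.foldr_cons, ← pd_JJ]
    change fderiv ℝ (L.foldr pd (GM A)) l (Pi.single x 1) = _ * fderiv ℝ (JJ A L) l (Pi.single x 1)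
    rw [hev.fderiv_eq]
    have := fderiv_const_smul_field (𝕜 := ℝ) (((2 * Real.pi : ℂ) ^ (Fintype.card R))⁻¹) (f := JJ A L)
    have := congrFun this l
    simp only [Pi.smul_def, smul_eq_mul] at this
    rw [this]
    rfl

/-- **Proposition 2.5(iii), derivative-free form of the density.** With `B` the
off-diagonal part of `A`,
`ρ_{ab}^{(R)}(l) = ∫_{[0,2π]^R} det_{ab}^{(R)}(−B + V_{θ,l})
  e^{Σ_{x,y} A_{x,y}√(l_x l_y) e^{i(θ_x−θ_y)}} ∏ dθ_x/(2π)`,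
where `V_{θ,l} = diag(v_{θ,l})`, `v_{θ,l}(x) = Σ_z B_{x,z} √(l_z/l_x) e^{i(θ_x−θ_z)}`. -/
theorem rho_eq_derivative_free_form
    {R : Type*} [Fintype R] [DecidableEq R]
    (A B : Matrix R R ℝ)
    (hB : ∀ x y, B x y = if x = y then 0 else A x y)
    (a b : R) (l : R → ℝ) (hl : ∀ x, 0 < l x) :
    rho A a b l
      = ((2 * Real.pi : ℂ) ^ (Fintype.card R))⁻¹ *
        ∫ θ in Set.univ.pi (fun _ : R => Set.Icc (0:ℝ) (2 * Real.pi)),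
          cofDet (Finset.univ : Finset R)
            ((-B).map (fun c => (c : ℂ)) +
              Matrix.diagonal (fun x => ∑ z, (B x z : ℂ) *
                (Real.sqrt (l z / l x) : ℂ) *
                Complex.exp (Complex.I * ((θ x : ℂ) - (θ z : ℂ))))) a b *
          Complex.exp (∑ x, ∑ y, (A x y : ℂ) * (Real.sqrt (l x * l y) : ℂ) *
            Complex.exp (Complex.I * ((θ x : ℂ) - (θ y : ℂ)))) := by
  set κ : ℂ := ((2 * Real.pi : ℂ) ^ (Fintype.card R))⁻¹
  set u : (R → ℝ) → R → ℂ := fun θ x => ∑ y, (A x y : ℂ) * (Real.sqrt (l y / l x) : ℂ) *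
        Complex.exp (Complex.I * ((θ x : ℂ) - (θ y : ℂ))) with hu
  set W : (R → ℝ) → ℂ := fun θ => Complex.exp (∑ x, ∑ y, (A x y : ℂ) *
    (Real.sqrt (l x * l y) : ℂ) * Complex.exp (Complex.I * ((θ x : ℂ) - (θ y : ℂ)))) with hW
  have hmat : ∀ θ : R → ℝ, (-B).map (fun c => (c : ℂ)) +
      Matrix.diagonal (fun x => ∑ z, (B x z : ℂ) * (Real.sqrt (l z / l x) : ℂ) *
        Complex.exp (Complex.I * ((θ x : ℂ) - (θ z : ℂ)))) =
      (-A).map (fun c => (c : ℂ)) + Matrix.diagonal (u θ) := by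
    intro θ
    ext x y
    simp only [Matrix.add_apply, Matrix.map_apply, Matrix.neg_apply, Matrix.diagonal_apply]
    by_cases hxy : x = y
    · subst hxy
      have : u θ x = (A x x : ℂ) + ∑ z, (B x z : ℂ) * (Real.sqrt (l z / l x) : ℂ) *
        Complex.exp (Complex.I * ((θ x : ℂ) - (θ z : ℂ))) := by
        rw [hu]
        dsimp only
        rw [← Finset.add_sum_erase _ _ (Finset.mem_univ x),
          ← Finset.add_sum_erase (a := x) Finset.univ (fun z => (B x z : ℂ) * _ * _)
            (Finset.mem_univ x)]
        have h1 : ∑ z ∈ Finset.univ.erase x, (A x z : ℂ) * (Real.sqrt (l z / l x) : ℂ) *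
            Complex.exp (Complex.I * ((θ x : ℂ) - (θ z : ℂ))) =
          ∑ z ∈ Finset.univ.erase x, (B x z : ℂ) * (Real.sqrt (l z / l x) : ℂ) *
            Complex.exp (Complex.I * ((θ x : ℂ) - (θ z : ℂ))) := by
          refine Finset.sum_congr rfl fun z hz => ?_
          rw [hB, if_neg (Finset.ne_of_mem_erase hz).symm]
        rw [h1, hB x x, if_pos rfl, div_self (hl x).ne']
        simp
      rw [if_pos rfl, if_pos rfl, this, hB x x, if_pos rfl]
      push_cast
      ring
    · rw [if_neg hxy, if_neg hxy, hB, if_neg hxy]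
  simp only [hmat, cofDet_expand]
  have hcu : ∀ x, Continuous (fun θ => u θ x) := fun x => by rw [hu]; fun_prop
  have hcW : Continuous W := by rw [hW]; fun_prop
  have hterm : ∀ Q : Finset R, mpart Q (GM A) l =
      κ * ∫ θ in Set.univ.pi (fun _ : R => Set.Icc (0:ℝ) (2 * Real.pi)),
        (∏ x ∈ Q, u θ x) * W θ := by
    intro Q
    unfold mpart
    rw [foldr_GM A _ l hl, JJ_shift A _ l hl]
    simp only [Finset.prod_map_toList, hu, hW]
    rfl
  unfold rho ddet
  simp only [hterm, Finset.sum_mul]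
  rw [integral_finsetSum, Finset.mul_sum]
  · refine Finset.sum_congr rfl fun Q _ => ?_
    rw [mul_left_comm, ← integral_const_mul]
    congr 2
    ext θ
    exact (mul_assoc _ _ _).symm
  · intro Q _
    refine ContinuousOn.integrableOn_compact (isCompact_box R) (Continuous.continuousOn ?_)
    exact (continuous_const.mul (continuous_finset_prod _ fun x _ => hcu x)).mul hcW

end
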